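/- arXiv:2309.00130 — 2 statements merged into one kernel-verified Lean document; each statement's English description precedes it below -/
import Mathlib

section
/- Let b = 10^9000, m = 10^7000, and let K₂ = { x ∈ [0,1] : x = Σ_{i≥1} d_i b^{−i} for some sequence of integers d_i with 0 ≤ d_i ≤ m − 1 }. Then the set { x² + y² : x, y ∈ K₂ } contains a nonempty open interval. -/
open scoped Real

noncomputable section

/-- The missing digits set in base `p` with digit set `{0,…,m-1}`:
numbers in `[0,1]` of the form `Σ_{i≥1} dᵢ p^{-i}` with all digits `dᵢ < m`. -/
def MDset (p m : ℕ) : Set ℝ :=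
  {x | x ∈ Set.Icc (0 : ℝ) 1 ∧
    ∃ d : ℕ → ℕ, (∀ i, d i < m) ∧ x = ∑' i : ℕ, (d i : ℝ) / (p : ℝ) ^ (i + 1)}

lemma step_aux (T : ℕ) (hT : 10 ≤ T) (z x y c : ℝ) (hc : 0 < c) (hc' : c * (T:ℝ)^27 ≤ 1)
    (hx0 : ((T:ℝ)^3)⁻¹ ≤ x) (hx1 : (x - ((T:ℝ)^3)⁻¹) * (T:ℝ)^18 ≤ 1)
    (hy0 : ((T:ℝ)^3)⁻¹ + ((T:ℝ)^6)⁻¹ ≤ y)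
    (hy1 : (y - (((T:ℝ)^3)⁻¹ + ((T:ℝ)^6)⁻¹)) * (T:ℝ)^18 ≤ 1)
    (h0 : (T:ℝ)^3 * c ≤ z - x^2 - y^2) (h1 : z - x^2 - y^2 ≤ 4 * (T:ℝ)^3 * c) :
    ∃ d e : ℕ, d < T^7 ∧ e < T^7 ∧
      ((T:ℝ)^6)⁻¹ * c ≤ z - (x + d * c)^2 - (y + e * c)^2 ∧
      z - (x + d * c)^2 - (y + e * c)^2 ≤ 4 * ((T:ℝ)^6)⁻¹ * c := by
  have hTr : (10:ℝ) ≤ T := by exact_mod_cast hT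
  have hT0 : (0:ℝ) < T := by linarith
  obtain ⟨ρ, hρ⟩ : ∃ ρ : ℝ, z - x^2 - y^2 = ρ * c := ⟨(z - x^2 - y^2) / c, by field_simp⟩
  have hρ0 : (T:ℝ)^3 ≤ ρ := by
    rw [hρ] at h0; exact le_of_mul_le_mul_right h0 hc
  have hρ1 : ρ ≤ 4 * (T:ℝ)^3 := by
    rw [hρ] at h1; exact le_of_mul_le_mul_right h1 hc
  have hT3 : (1000:ℝ) ≤ (T:ℝ)^3 := by
    calc (1000:ℝ) = 10^3 := by norm_num
      _ ≤ _ := by gcongr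
  have hT6 : (T:ℝ)^6 = (T:ℝ)^3 * (T:ℝ)^3 := by ring
  have hT9 : (T:ℝ)^9 = (T:ℝ)^3 * (T:ℝ)^6 := by ring
  have hT6' : (1000:ℝ) ≤ (T:ℝ)^6 := by nlinarith
  have hb : (T:ℝ)^9 ≤ ρ * (T:ℝ)^6 := by rw [hT9]; gcongr
  have hb' : ρ * (T:ℝ)^6 ≤ 4 * (T:ℝ)^9 := by rw [hT9, ← mul_assoc]; gcongr
  have hb9 : 1000 * (T:ℝ)^6 ≤ (T:ℝ)^9 := by rw [hT9]; gcongr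
  have hT10 : 10 * (T:ℝ)^9 ≤ (T:ℝ)^10 := by
    rw [show (T:ℝ)^10 = T * (T:ℝ)^9 by ring]; gcongr
  set N : ℕ := ⌊ρ * (T:ℝ)^6 / 2 - 1⌋₊ with hN
  have hN1 : (N:ℝ) ≤ ρ * (T:ℝ)^6 / 2 - 1 := Nat.floor_le (by linarith)
  have hN2 : ρ * (T:ℝ)^6 / 2 - 1 < N + 1 := Nat.lt_floor_add_one _
  have hNlo : T^6 ≤ N := by
    have : ((T^6 : ℕ):ℝ) ≤ N := by push_cast; linarith
    exact_mod_cast this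
  have hNhi : N < T^10 := by
    have : (N:ℝ) < ((T^10 : ℕ):ℝ) := by push_cast; linarith
    exact_mod_cast this
  have hTpos : 0 < T := by omega
  have hq : 0 < T^3 := by positivity
  have he : N % T^3 < T^3 := Nat.mod_lt _ hq
  have hdq : T^3 ≤ N / T^3 := by
    rw [Nat.le_div_iff_mul_le hq]; calc T^3 * T^3 = T^6 := by ring
      _ ≤ N := hNlo
  have hdq' : N / T^3 < T^7 := by
    rw [Nat.div_lt_iff_lt_mul hq]; calc N < T^10 := hNhi
      _ = T^7 * T^3 := by ring
  have h37 : T^3 ≤ T^7 := Nat.pow_le_pow_right hTpos (by norm_num)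
  obtain ⟨d, hd⟩ : ∃ d, N / T^3 = d + N % T^3 := ⟨N / T^3 - N % T^3, by omega⟩
  set e := N % T^3 with hedef
  have hsum : T^3 * (d + e) + e = N := by rw [← hd, hedef]; exact Nat.div_add_mod _ _
  have hd7 : d < T^7 := (Nat.le_add_right d e).trans_lt (hd ▸ hdq')
  have he7 : e < T^7 := by omega
  have hsumr : (T:ℝ)^3 * (d + e) + e = N := by exact_mod_cast hsum
  refine ⟨d, e, hd7, he7, ?_⟩
  have hdr : (d:ℝ) ≤ (T:ℝ)^7 := by exact_mod_cast hd7.le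
  have her : (e:ℝ) ≤ (T:ℝ)^7 := by exact_mod_cast he7.le
  have hd0 : (0:ℝ) ≤ d := Nat.cast_nonneg _
  have he0 : (0:ℝ) ≤ e := Nat.cast_nonneg _
  set u := x - ((T:ℝ)^3)⁻¹ with hu
  set v := y - (((T:ℝ)^3)⁻¹ + ((T:ℝ)^6)⁻¹) with hv
  have hu0 : 0 ≤ u := by linarith
  have hv0 : 0 ≤ v := by linarith
  have hlin : x * d + y * e = ((T:ℝ)^6)⁻¹ * N + (u * d + v * e) := by
    rw [← hsumr, hu, hv]; field_simp; ring
  set δ := ((T:ℝ)^6)⁻¹ with hδ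
  have hδT : δ * (T:ℝ)^6 = 1 := by rw [hδ]; field_simp
  have hδ0 : 0 < δ := by positivity
  have key : z - (x + d * c)^2 - (y + e * c)^2
      = (ρ - 2 * δ * N - (2 * (u * d + v * e) + (d^2+e^2) * c)) * c := by
    have : z - (x + d * c)^2 - (y + e * c)^2
      = (z - x^2 - y^2) - (2 * (x * d + y * e) + (d^2+e^2) * c) * c := by ring
    rw [this, hρ, hlin]; ring
  have a1 : 2 * δ * N ≤ ρ - 2 * δ := by
    have := mul_le_mul_of_nonneg_left hN1 (by positivity : 0 ≤ 2 * δ)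
    have e1 : 2 * δ * (ρ * (T:ℝ)^6 / 2 - 1) = ρ * (δ * (T:ℝ)^6) - 2 * δ := by ring
    rw [e1, hδT] at this; linarith
  have a2 : ρ - 4 * δ ≤ 2 * δ * N := by
    have := mul_le_mul_of_nonneg_left hN2.le (by positivity : 0 ≤ 2 * δ)
    have e1 : 2 * δ * (ρ * (T:ℝ)^6 / 2 - 1) = ρ * (δ * (T:ℝ)^6) - 2 * δ := by ring
    rw [e1, hδT] at this; linarith
  have b1 : ∀ w f : ℝ, 0 ≤ w → w * (T:ℝ)^18 ≤ 1 → 0 ≤ f → f ≤ (T:ℝ)^7 → 10 * (w * f) ≤ δ := by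
    intro w f hw hw1 hf hf1
    calc 10 * (w * f) ≤ (T:ℝ)^5 * (w * (T:ℝ)^7) := by
          have : (10:ℝ) ≤ (T:ℝ)^5 := hTr.trans (le_self_pow₀ (by linarith) (by norm_num))
          gcongr
      _ = (w * (T:ℝ)^18) * δ := by rw [hδ]; field_simp
      _ ≤ 1 * δ := by gcongr
      _ = δ := one_mul _
  have b2 : ∀ f : ℝ, 0 ≤ f → f ≤ (T:ℝ)^7 → 10 * (f^2 * c) ≤ δ := by
    intro f hf hf1
    calc 10 * (f^2 * c) ≤ (T:ℝ)^7 * (((T:ℝ)^7)^2 * c) := by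
          have : (10:ℝ) ≤ (T:ℝ)^7 := hTr.trans (le_self_pow₀ (by linarith) (by norm_num))
          gcongr
      _ = (c * (T:ℝ)^27) * δ := by rw [hδ]; field_simp
      _ ≤ 1 * δ := by gcongr
      _ = δ := one_mul _
  have c1 := b1 u d hu0 hx1 hd0 hdr
  have c2 := b1 v e hv0 hy1 he0 her
  have c3 := b2 d hd0 hdr
  have c4 := b2 e he0 her
  have p1 : 0 ≤ u * d := by positivity
  have p2 : 0 ≤ v * e := by positivity
  have p3 : 0 ≤ (d:ℝ)^2 * c := by positivity
  have p4 : 0 ≤ (e:ℝ)^2 * c := by positivity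
  rw [key]
  constructor
  · apply mul_le_mul_of_nonneg_right _ hc.le
    linarith
  · apply mul_le_mul_of_nonneg_right _ hc.le
    linarith

/-- the invariant -/
def Inv17 (T : ℕ) (z : ℝ) (n : ℕ) (s : ℝ × ℝ) : Prop :=
  ((T:ℝ)^3)⁻¹ ≤ s.1 ∧ s.1 + (((T:ℝ)^9)^(n+2))⁻¹ ≤ ((T:ℝ)^3)⁻¹ + ((T:ℝ)^18)⁻¹ ∧
  ((T:ℝ)^3)⁻¹ + ((T:ℝ)^6)⁻¹ ≤ s.2 ∧
  s.2 + (((T:ℝ)^9)^(n+2))⁻¹ ≤ ((T:ℝ)^3)⁻¹ + ((T:ℝ)^6)⁻¹ + ((T:ℝ)^18)⁻¹ ∧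
  ((T:ℝ)^6)⁻¹ * (((T:ℝ)^9)^(n+2))⁻¹ ≤ z - s.1^2 - s.2^2 ∧
  z - s.1^2 - s.2^2 ≤ 4 * ((T:ℝ)^6)⁻¹ * (((T:ℝ)^9)^(n+2))⁻¹

lemma inv_step (T : ℕ) (hT : 10 ≤ T) (z : ℝ) (n : ℕ) (s : ℝ × ℝ) (h : Inv17 T z n s) :
    ∃ d e : ℕ, d < T^7 ∧ e < T^7 ∧
      Inv17 T z (n+1) (s.1 + d / ((T:ℝ)^9)^(n+3), s.2 + e / ((T:ℝ)^9)^(n+3)) := by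
  obtain ⟨x, y⟩ := s
  obtain ⟨h1, h2, h3, h4, h5, h6⟩ := h
  simp only at h1 h2 h3 h4 h5 h6
  have hTr : (10:ℝ) ≤ T := by exact_mod_cast hT
  have hT0 : (0:ℝ) < T := by linarith
  set c : ℝ := (((T:ℝ)^9)^(n+3))⁻¹ with hc
  have hc0 : 0 < c := by positivity
  have hbc : (((T:ℝ)^9)^(n+2))⁻¹ = (T:ℝ)^9 * c := by
    rw [hc, pow_succ _ (n+2)]; field_simp
  have hc27 : c * (T:ℝ)^27 ≤ 1 := by
    rw [hc, inv_mul_le_iff₀ (by positivity), mul_one, ← pow_mul]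
    exact pow_le_pow_right₀ (by linarith) (by omega)
  rw [hbc] at h2 h4 h5 h6
  have hpos : 0 < (T:ℝ)^9 * c := by positivity
  have h18 : ((T:ℝ)^18)⁻¹ * (T:ℝ)^18 = 1 := by field_simp
  obtain ⟨d, e, hd, he, g1, g2⟩ := step_aux T hT z x y c hc0 hc27 h1
    (by rw [← h18]; gcongr; linarith) h3 (by rw [← h18]; gcongr; linarith)
    (by convert h5 using 1; field_simp) (by convert h6 using 1; field_simp)
  refine ⟨d, e, hd, he, ?_⟩
  have h79 : T^7 ≤ T^9 := Nat.pow_le_pow_right (by omega) (by norm_num)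
  have hdr : (d:ℝ) + 1 ≤ (T:ℝ)^9 := by exact_mod_cast hd.trans_le h79
  have her : (e:ℝ) + 1 ≤ (T:ℝ)^9 := by exact_mod_cast he.trans_le h79
  have hdr' := mul_le_mul_of_nonneg_right hdr hc0.le
  have her' := mul_le_mul_of_nonneg_right her hc0.le
  have q1 : 0 ≤ (d:ℝ) * c := by positivity
  have q2 : 0 ≤ (e:ℝ) * c := by positivity
  simp only [Inv17, div_eq_mul_inv, show n + 1 + 2 = n + 3 from rfl, ← hc]
  exact ⟨by linarith, by linarith, by linarith, by linarith, g1, g2⟩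

lemma mem_aux (T : ℕ) (hT : 10 ≤ T) (d0 : ℕ) (hd0 : d0 < T^7) (d : ℕ → ℕ) (hd : ∀ i, d i < T^7)
    (x : ℕ → ℝ) (hx0 : x 0 = d0 / (T:ℝ)^9)
    (hx : ∀ n, x (n+1) = x n + d n / ((T:ℝ)^9)^(n+3)) (hx1 : ∀ n, x n ≤ 1) :
    ∃ l ∈ MDset (T^9) (T^7), Filter.Tendsto x Filter.atTop (nhds l) := by
  let D : ℕ → ℕ := fun n => match n with
    | 0 => d0
    | 1 => 0
    | (n+2) => d n
  let f : ℕ → ℝ := fun i => (D i : ℝ) / ((T^9 : ℕ) : ℝ)^(i+1)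
  have hf0 : ∀ i, 0 ≤ f i := fun i => by positivity
  have hps : ∀ n, ∑ i ∈ Finset.range (n+2), f i = x n := by
    intro n
    induction n with
    | zero => simp [Finset.sum_range_succ, f, D, hx0]
    | succ n ih =>
      rw [show n + 1 + 2 = (n+2) + 1 from rfl, Finset.sum_range_succ, ih, hx]
      simp [f, D]
  have hle : ∀ n, ∑ i ∈ Finset.range n, f i ≤ 1 := by
    intro n
    calc _ ≤ ∑ i ∈ Finset.range (n+2), f i :=
          Finset.sum_le_sum_of_subset_of_nonneg (by simp) (fun i _ _ => hf0 i)
      _ ≤ 1 := by rw [hps]; exact hx1 n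
  have hsum : Summable f := summable_of_sum_range_le hf0 hle
  refine ⟨∑' i, f i, ⟨⟨tsum_nonneg hf0, hsum.tsum_le_of_sum_range_le hle⟩, D, ?_, rfl⟩, ?_⟩
  · intro i
    match i with
    | 0 => exact hd0
    | 1 => exact lt_of_le_of_lt (Nat.zero_le _) hd0
    | (n+2) => exact hd n
  · have := (Filter.tendsto_add_atTop_iff_nat 2).2 hsum.hasSum.tendsto_sum_nat
    simpa only [hps] using this

lemma main_aux (T : ℕ) (hT : 10 ≤ T) :
    ∃ a b : ℝ, a < b ∧ Set.Ioo a b ⊆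
      {z : ℝ | ∃ x ∈ MDset (T ^ 9) (T ^ 7), ∃ y ∈ MDset (T ^ 9) (T ^ 7),
        z = x ^ 2 + y ^ 2} := by
  have hTr : (10:ℝ) ≤ T := by exact_mod_cast hT
  have hT0 : (0:ℝ) < T := by linarith
  set x1 : ℝ := ((T:ℝ)^3)⁻¹ with hx1
  set y1 : ℝ := ((T:ℝ)^3)⁻¹ + ((T:ℝ)^6)⁻¹ with hy1
  set w : ℝ := ((T:ℝ)^6)⁻¹ * (((T:ℝ)^9)^2)⁻¹ with hw
  have hw0 : 0 < w := by positivity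
  refine ⟨x1^2 + y1^2 + w, x1^2 + y1^2 + 4 * w, by linarith, ?_⟩
  rintro z ⟨hz1, hz2⟩
  have hinit : Inv17 T z 0 (x1, y1) := by
    refine ⟨le_rfl, ?_, le_rfl, ?_, ?_, ?_⟩
    · simp only [← pow_mul]; exact le_rfl
    · simp only [← pow_mul]; exact le_rfl
    · simp only [zero_add]; linarith
    · simp only [zero_add]; linarith
  choose! nd ne hnd hne hnext using inv_step T hT z
  let S : (n : ℕ) → {s : ℝ × ℝ // Inv17 T z n s} := fun n =>
    Nat.rec ⟨(x1, y1), hinit⟩ (fun n s => ⟨_, hnext n s.1 s.2⟩) n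
  have hS : ∀ n, (S (n+1)).1 = ((S n).1.1 + nd n (S n).1 / ((T:ℝ)^9)^(n+3),
      (S n).1.2 + ne n (S n).1 / ((T:ℝ)^9)^(n+3)) := fun n => rfl
  have hi : ∀ k : ℕ, k ≠ 0 → ((T:ℝ)^k)⁻¹ ≤ 1/10 := by
    intro k hk
    rw [one_div]
    exact inv_anti₀ (by norm_num) (hTr.trans (le_self_pow₀ (by linarith) hk))
  have h3 := hi 3 (by norm_num)
  have h6 := hi 6 (by norm_num)
  have h18 := hi 18 (by norm_num)
  have hT67 : T^6 + T^3 < T^7 := by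
    have h1 : T^7 = T * T^6 := by ring
    have h2 : T^3 ≤ T^6 := Nat.pow_le_pow_right (by omega) (by norm_num)
    have h4 : 0 < T^6 := by positivity
    nlinarith
  obtain ⟨x, hxm, hxt⟩ := mem_aux T hT (T^6) (by omega) (fun n => nd n (S n).1)
    (fun n => hnd n _ (S n).2) (fun n => (S n).1.1)
    (by change x1 = _; rw [hx1]; push_cast; field_simp) (fun n => by rw [hS])
    (fun n => by
      have := (S n).2.2.1
      have hp : 0 ≤ (((T:ℝ)^9)^(n+2))⁻¹ := by positivity
      linarith)
  obtain ⟨y, hym, hyt⟩ := mem_aux T hT (T^6 + T^3) hT67 (fun n => ne n (S n).1)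
    (fun n => hne n _ (S n).2) (fun n => (S n).1.2)
    (by change y1 = _; rw [hy1]; push_cast; field_simp) (fun n => by rw [hS])
    (fun n => by
      have := (S n).2.2.2.2.1
      have hp : 0 ≤ (((T:ℝ)^9)^(n+2))⁻¹ := by positivity
      linarith)
  refine ⟨x, hxm, y, hym, ?_⟩
  have ht := ((tendsto_const_nhds (x := z)).sub (hxt.pow 2)).sub (hyt.pow 2)
  have hpow : Filter.Tendsto (fun n : ℕ => 4 * ((T:ℝ)^6)⁻¹ * (((T:ℝ)^9)^(n+2))⁻¹)
      Filter.atTop (nhds 0) := by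
    have hb : (1:ℝ) < (T:ℝ)^9 := one_lt_pow₀ (by linarith) (by norm_num)
    have := (tendsto_pow_atTop_nhds_zero_of_lt_one (r := ((T:ℝ)^9)⁻¹) (by positivity)
      (inv_lt_one_of_one_lt₀ hb))
    have := ((Filter.tendsto_add_atTop_iff_nat 2).2 this).const_mul (4 * ((T:ℝ)^6)⁻¹)
    simpa only [mul_zero, inv_pow] using this
  have hz0 : Filter.Tendsto (fun n => z - (S n).1.1^2 - (S n).1.2^2) Filter.atTop (nhds 0) :=
    squeeze_zero (fun n => le_trans (by positivity) (S n).2.2.2.2.2.1)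
      (fun n => (S n).2.2.2.2.2.2) hpow
  have := tendsto_nhds_unique ht hz0
  linarith

lemma main_aux_exp (n a c : ℕ) (hn : n ≠ 0) (ha : a = n * 9) (hc : c = n * 7) :
    ∃ a' b' : ℝ, a' < b' ∧ Set.Ioo a' b' ⊆
      {z : ℝ | ∃ x ∈ MDset (10 ^ a) (10 ^ c), ∃ y ∈ MDset (10 ^ a) (10 ^ c),
        z = x ^ 2 + y ^ 2} := by
  subst ha hc
  have h := main_aux (10 ^ n) (le_self_pow₀ (by norm_num) hn)
  rw [← pow_mul, ← pow_mul] at h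
  exact h

/-- with `K₂` the set of numbers in `[0,1]` whose base-`10^9000` expansions
use only the digits `0,…,10^7000 - 1`, the set `{x² + y² : x, y ∈ K₂}` contains a nonempty
open interval. -/
theorem statement17 :
    ∃ a b : ℝ, a < b ∧ Set.Ioo a b ⊆
      {z : ℝ | ∃ x ∈ MDset (10 ^ 9000) (10 ^ 7000), ∃ y ∈ MDset (10 ^ 9000) (10 ^ 7000),
        z = x ^ 2 + y ^ 2} := by
  exact main_aux_exp 1000 9000 7000 (by norm_num) (by norm_num) (by norm_num)
end
end

section
/- Let b = 10^9000, m = 10^7000, and let K₂ = { x ∈ [0,1] : x = Σ_{i≥1} d_i b^{−i} for some sequence of integers d_i with 0 ≤ d_i ≤ m − 1 }. Then the arithmetic product set K₂·K₂ = { x·y : x, y ∈ K₂ } has nonempty interior, i.e. it contains a nonempty open interval. -/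
open scoped Real

noncomputable section

theorem aux_greedy (m : ℕ) (hm : 1 ≤ m) (w u : ℝ) (hw : 0 ≤ w) (hu : 0 < u) :
    ∃ d : ℕ, d < m ∧ (d : ℝ) * u ≤ w ∧ (w - d * u ≤ u ∨ w - d * u = w - ((m : ℝ) - 1) * u) := by
  have h1 : (⌊w / u⌋₊ : ℝ) ≤ w / u := Nat.floor_le (by positivity)
  have h2 : w / u < ⌊w / u⌋₊ + 1 := Nat.lt_floor_add_one _
  rw [le_div_iff₀ hu] at h1
  rw [div_lt_iff₀ hu] at h2
  by_cases h : ⌊w / u⌋₊ < m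
  · exact ⟨_, h, h1, Or.inl (by linarith)⟩
  · push Not at h
    have h3 : ((m : ℝ)) ≤ ⌊w / u⌋₊ := by exact_mod_cast h
    refine ⟨m - 1, by omega, ?_, Or.inr ?_⟩
    · push_cast [hm]
      nlinarith
    · push_cast [hm]
      ring

theorem aux_step (m : ℕ) (hm : 1 ≤ m) (q r x y z s t : ℝ) (hq : 0 < q) (hr : 1 ≤ r)
    (hmq : (m : ℝ) ≤ q) (hrm : r + 1 ≤ (m : ℝ) - 1) (hqm : 2 * q ≤ ((m : ℝ) - 1) * r)
    (ht : 0 < t) (hs : s = q * t)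
    (h1 : 1 ≤ q * x) (h2 : q * (x + s) ≤ 2) (h3 : r ≤ q * y) (h4 : q * (y + s) ≤ r + 1)
    (h5 : 0 ≤ z - x * y) (h6 : q * (z - x * y) ≤ 2 * s) :
    ∃ d e : ℕ, d < m ∧ e < m ∧
      1 ≤ q * (x + d * t) ∧ q * (x + d * t + t) ≤ 2 ∧
      r ≤ q * (y + e * t) ∧ q * (y + e * t + t) ≤ r + 1 ∧
      0 ≤ z - (x + d * t) * (y + e * t) ∧
      q * (z - (x + d * t) * (y + e * t)) ≤ 2 * t := by
  have hx : 0 < x := by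
    by_contra h
    push Not at h
    nlinarith
  have hy : 0 < y := by
    by_contra h
    push Not at h
    nlinarith
  obtain ⟨d, hd, hd1, hd2⟩ := aux_greedy m hm (z - x * y) (t * y) h5 (by positivity)
  have hdm : (d : ℝ) + 1 ≤ m := by exact_mod_cast hd
  have hx' : 0 < x + d * t := by positivity
  have hty : 0 < t * y := by positivity
  have hw' : z - x * y - d * (t * y) ≤ t * y := by
    rcases hd2 with h | h
    · exact h
    · rw [h]
      have : q * (z - x * y - ((m : ℝ) - 1) * (t * y)) ≤ 0 := by
        have a1 : ((m : ℝ) - 1) * t * r ≤ ((m : ℝ) - 1) * t * (q * y) := by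
          apply mul_le_mul_of_nonneg_left h3
          apply mul_nonneg _ ht.le
          linarith
        have a2 := mul_le_mul_of_nonneg_right hqm ht.le
        subst hs
        nlinarith
      have := nonpos_of_mul_nonpos_right this hq
      linarith
  obtain ⟨e, he, he1, he2⟩ := aux_greedy m hm (z - x * y - d * (t * y)) (t * (x + d * t))
    (by linarith) (by positivity)
  have hem : (e : ℝ) + 1 ≤ m := by exact_mod_cast he
  have hprod : z - (x + d * t) * (y + e * t)
      = z - x * y - d * (t * y) - e * (t * (x + d * t)) := by ring
  have hdt : d * t + t ≤ s := by
    rw [hs]; nlinarith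
  have het : e * t + t ≤ s := by
    rw [hs]; nlinarith
  have b1 : 1 ≤ q * (x + d * t) := by
    have : 0 ≤ q * (d * t) := by positivity
    linarith
  have b2 : q * (x + d * t + t) ≤ 2 := by
    have := mul_le_mul_of_nonneg_left hdt hq.le
    linarith
  have b3 : r ≤ q * (y + e * t) := by
    have : 0 ≤ q * (e * t) := by positivity
    linarith
  have b4 : q * (y + e * t + t) ≤ r + 1 := by
    have := mul_le_mul_of_nonneg_left het hq.le
    linarith
  refine ⟨d, e, hd, he, b1, b2, b3, b4, ?_, ?_⟩
  · rw [hprod]; linarith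
  · rw [hprod]
    have hqt : 0 < q * t := by positivity
    rcases he2 with h | h
    · have c1 := mul_le_mul_of_nonneg_left h hq.le
      have c2 : t * (q * (x + d * t)) ≤ t * 2 :=
        mul_le_mul_of_nonneg_left (by linarith) ht.le
      linarith
    · rw [h]
      have c1 := mul_le_mul_of_nonneg_left hw' hq.le
      have c2 : t * (q * y) ≤ t * (r + 1) :=
        mul_le_mul_of_nonneg_left (by nlinarith) ht.le
      have c3 : ((m : ℝ) - 1) * t * 1 ≤ ((m : ℝ) - 1) * t * (q * (x + d * t)) := by
        apply mul_le_mul_of_nonneg_left b1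
        apply mul_nonneg _ ht.le
        linarith
      nlinarith

theorem aux_mem (p m : ℕ) (d : ℕ → ℕ) (hd : ∀ i, d i < m) 
    (h : ∀ n, ∑ i ∈ Finset.range (n + 1), (d i : ℝ) / (p : ℝ) ^ (i + 1) ≤ 1) :
    ∃ x ∈ MDset p m, Filter.Tendsto
      (fun n => ∑ i ∈ Finset.range (n + 1), (d i : ℝ) / (p : ℝ) ^ (i + 1))
      Filter.atTop (nhds x) := by
  have h0 : ∀ i, 0 ≤ (d i : ℝ) / (p : ℝ) ^ (i + 1) := fun i => by positivity
  have h' : ∀ n, ∑ i ∈ Finset.range n, (d i : ℝ) / (p : ℝ) ^ (i + 1) ≤ 1 := by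
    intro n
    refine le_trans ?_ (h n)
    rw [Finset.sum_range_succ]
    linarith [h0 n]
  have hs : Summable fun i => (d i : ℝ) / (p : ℝ) ^ (i + 1) := summable_of_sum_range_le h0 h'
  refine ⟨_, ⟨⟨tsum_nonneg h0, hs.tsum_le_of_sum_range_le h'⟩, d, hd, rfl⟩, ?_⟩
  exact (hs.hasSum.tendsto_sum_nat).comp (Filter.tendsto_add_atTop_nat 1)

theorem aux_main (p m r : ℕ) (hr : 1 ≤ r) (hmp : m ≤ p) (hrm : r + 2 ≤ m)
    (hpm : 2 * p + r ≤ m * r) (z : ℝ)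
    (hz0 : (1 / (p : ℝ)) * (r / p) ≤ z) (hz1 : p * (z - (1 / (p : ℝ)) * (r / p)) ≤ 2 * (1 / p)) :
    ∃ x ∈ MDset p m, ∃ y ∈ MDset p m, z = x * y := by
  have hp3 : 3 ≤ p := by omega
  have hq3 : (3 : ℝ) ≤ p := by exact_mod_cast hp3
  have hq : (0 : ℝ) < p := by linarith
  have hrR : (1 : ℝ) ≤ r := by exact_mod_cast hr
  have hmR : (m : ℝ) ≤ p := by exact_mod_cast hmp
  have hrmR : (r : ℝ) + 2 ≤ m := by exact_mod_cast hrm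
  have hpmR : (2 : ℝ) * p + r ≤ m * r := by exact_mod_cast hpm
  let P : ℕ → ℝ × ℝ → Prop := fun n v =>
    1 ≤ p * v.1 ∧ p * (v.1 + 1 / (p : ℝ) ^ (n + 1)) ≤ 2 ∧
    r ≤ p * v.2 ∧ p * (v.2 + 1 / (p : ℝ) ^ (n + 1)) ≤ r + 1 ∧
    0 ≤ z - v.1 * v.2 ∧ p * (z - v.1 * v.2) ≤ 2 * (1 / (p : ℝ) ^ (n + 1))
  have hstep : ∀ n v, ∃ d e : ℕ, d < m ∧ e < m ∧ (P n v →
      P (n + 1) (v.1 + d * (1 / (p : ℝ) ^ (n + 1 + 1)), v.2 + e * (1 / (p : ℝ) ^ (n + 1 + 1)))) := by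
    intro n v
    by_cases hv : P n v
    · obtain ⟨a1, a2, a3, a4, a5, a6⟩ := hv
      obtain ⟨d, e, hd, he, hh⟩ := aux_step m (by omega) p r v.1 v.2 z (1 / (p : ℝ) ^ (n + 1))
        (1 / (p : ℝ) ^ (n + 1 + 1)) hq hrR hmR (by linarith) (by linarith) (by positivity)
        (by rw [pow_succ (p : ℝ) (n + 1)]; field_simp) a1 a2 a3 a4 a5 a6
      exact ⟨d, e, hd, he, fun _ => hh⟩
    · exact ⟨0, 0, by omega, by omega, fun h => absurd h hv⟩
  choose D E hD hE hDE using hstep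
  let st : ℕ → ℝ × ℝ := fun n => Nat.rec (1 / (p : ℝ), (r : ℝ) / p)
    (fun n v => (v.1 + D n v * (1 / (p : ℝ) ^ (n + 1 + 1)),
      v.2 + E n v * (1 / (p : ℝ) ^ (n + 1 + 1)))) n
  have hP : ∀ n, P n (st n) := by
    intro n
    induction n with
    | zero =>
      refine ⟨?_, ?_, ?_, ?_, ?_, ?_⟩
      · change 1 ≤ (p : ℝ) * (1 / p); field_simp; rfl
      · change (p : ℝ) * (1 / p + 1 / (p : ℝ) ^ (0 + 1)) ≤ 2; simp; field_simp; norm_num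
      · change (r : ℝ) ≤ p * (r / p); field_simp; rfl
      · change (p : ℝ) * (r / p + 1 / (p : ℝ) ^ (0 + 1)) ≤ r + 1; simp; field_simp; rfl
      · change 0 ≤ z - 1 / (p : ℝ) * (r / p); linarith
      · change (p : ℝ) * (z - 1 / (p : ℝ) * (r / p)) ≤ 2 * (1 / (p : ℝ) ^ (0 + 1))
        simpa using hz1
    | succ n ih => exact hDE n (st n) ih
  obtain ⟨d, hd0, hds⟩ : ∃ f : ℕ → ℕ, f 0 = 1 ∧ ∀ k, f (k + 1) = D k (st k) :=
    ⟨fun n => Nat.casesOn n 1 (fun k => D k (st k)), rfl, fun _ => rfl⟩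
  obtain ⟨e, he0, hes⟩ : ∃ f : ℕ → ℕ, f 0 = r ∧ ∀ k, f (k + 1) = E k (st k) :=
    ⟨fun n => Nat.casesOn n r (fun k => E k (st k)), rfl, fun _ => rfl⟩
  have hd : ∀ i, d i < m := by
    intro i
    cases i with
    | zero => rw [hd0]; omega
    | succ k => rw [hds]; exact hD k _
  have he : ∀ i, e i < m := by
    intro i
    cases i with
    | zero => rw [he0]; omega
    | succ k => rw [hes]; exact hE k _
  have hsd : ∀ n : ℕ, ∑ i ∈ Finset.range (n + 1), ((d i : ℕ) : ℝ) / (p : ℝ) ^ (i + 1) = (st n).1 := by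
    intro n
    induction n with
    | zero => simp [hd0, st]
    | succ n ih =>
      rw [Finset.sum_range_succ, ih, hds]
      change _ + (D n (st n) : ℝ) / _ = (st n).1 + D n (st n) * (1 / (p : ℝ) ^ (n + 1 + 1))
      rw [mul_one_div]
  have hse : ∀ n : ℕ, ∑ i ∈ Finset.range (n + 1), ((e i : ℕ) : ℝ) / (p : ℝ) ^ (i + 1) = (st n).2 := by
    intro n
    induction n with
    | zero => simp [he0, st]
    | succ n ih =>
      rw [Finset.sum_range_succ, ih, hes]
      change _ + (E n (st n) : ℝ) / _ = (st n).2 + E n (st n) * (1 / (p : ℝ) ^ (n + 1 + 1))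
      rw [mul_one_div]
  obtain ⟨x, hx, hxl⟩ := aux_mem p m d hd (by
    intro n
    rw [hsd]
    obtain ⟨a1, a2, -⟩ := hP n
    have : 0 < 1 / (p : ℝ) ^ (n + 1) := by positivity
    by_contra hc
    push Not at hc
    nlinarith)
  obtain ⟨y, hy, hyl⟩ := aux_mem p m e he (by
    intro n
    rw [hse]
    obtain ⟨-, -, a1, a2, -⟩ := hP n
    have : 0 < 1 / (p : ℝ) ^ (n + 1) := by positivity
    by_contra hc
    push Not at hc
    nlinarith)
  simp only [hsd] at hxl
  simp only [hse] at hyl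
  refine ⟨x, hx, y, hy, ?_⟩
  have hl : Filter.Tendsto (fun n => p * (z - (st n).1 * (st n).2)) Filter.atTop
      (nhds (p * (z - x * y))) := ((hxl.mul hyl).const_sub z).const_mul _
  have hl0 : Filter.Tendsto (fun n : ℕ => 2 * (1 / (p : ℝ) ^ (n + 1))) Filter.atTop
      (nhds (2 * 0)) := by
    apply Filter.Tendsto.const_mul
    have := (tendsto_pow_atTop_nhds_zero_of_lt_one (r := 1 / (p : ℝ)) (by positivity)
      (by rw [div_lt_one hq]; linarith)).comp (Filter.tendsto_add_atTop_nat 1)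
    refine this.congr fun n => ?_
    simp
  have g1 : p * (z - x * y) ≤ 2 * 0 := le_of_tendsto_of_tendsto' hl hl0 fun n => (hP n).2.2.2.2.2
  have g2 : 0 ≤ p * (z - x * y) :=
    ge_of_tendsto' hl fun n => mul_nonneg hq.le (hP n).2.2.2.2.1
  have g3 : p * (z - x * y) = 0 := by linarith
  have := (mul_eq_zero.1 g3).resolve_left hq.ne'
  linarith

theorem aux_final (p m r : ℕ) (hr : 1 ≤ r) (hmp : m ≤ p) (hrm : r + 2 ≤ m)
    (hpm : 2 * p + r ≤ m * r) :
    ∃ a b : ℝ, a < b ∧ Set.Ioo a b ⊆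
      {z : ℝ | ∃ x ∈ MDset p m, ∃ y ∈ MDset p m, z = x * y} := by
  have hp3 : 3 ≤ p := by omega
  have hq3 : (3 : ℝ) ≤ p := by exact_mod_cast hp3
  have hq : (0 : ℝ) < p := by linarith
  refine ⟨(1 / (p : ℝ)) * (r / p), (1 / (p : ℝ)) * (r / p) + 2 * (1 / p) / p, ?_, ?_⟩
  · have : 0 < 2 * (1 / (p : ℝ)) / p := by positivity
    linarith
  · intro z hz
    refine aux_main p m r hr hmp hrm hpm z hz.1.le ?_
    have h := hz.2
    have h2 : z - (1 / (p : ℝ)) * (r / p) ≤ 2 * (1 / p) / p := by linarith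
    rw [le_div_iff₀ hq] at h2
    linarith

theorem aux_pow (T : ℕ) (hT : 4 ≤ T) (a b c : ℕ) (hab : b ≤ a) (hcb : c + 1 ≤ b) 
    (habc : a + 1 ≤ b + c) : 
    1 ≤ T ^ c ∧ T ^ b ≤ T ^ a ∧ T ^ c + 2 ≤ T ^ b ∧ 2 * T ^ a + T ^ c ≤ T ^ b * T ^ c := by
  have h1 : 1 ≤ T ^ c := Nat.one_le_pow _ _ (by omega)
  have h2 : T ^ (c + 1) ≤ T ^ b := Nat.pow_le_pow_right (by omega) hcb
  have h3 : T ^ (a + 1) ≤ T ^ (b + c) := Nat.pow_le_pow_right (by omega) habc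
  have h4 : T ^ b ≤ T ^ a := Nat.pow_le_pow_right (by omega) hab
  rw [pow_succ] at h2 h3
  rw [pow_add] at h3
  have h5 : T ^ c ≤ T ^ b := Nat.pow_le_pow_right (by omega) (by omega)
  have h6 : T ^ a * 4 ≤ T ^ a * T := Nat.mul_le_mul_left _ hT
  refine ⟨h1, h4, by nlinarith, by omega⟩

/-- with `K₂` the set of numbers in `[0,1]` whose base-`10^9000` expansions
use only the digits `0,…,10^7000 - 1`, the arithmetic product set
`K₂·K₂ = {x·y : x, y ∈ K₂}` has nonempty interior, i.e. contains a nonempty open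
interval. -/
theorem statement18 :
    ∃ a b : ℝ, a < b ∧ Set.Ioo a b ⊆
      {z : ℝ | ∃ x ∈ MDset (10 ^ 9000) (10 ^ 7000), ∃ y ∈ MDset (10 ^ 9000) (10 ^ 7000),
        z = x * y} := by
  obtain ⟨h1, h2, h3, h4⟩ := aux_pow 10 (by norm_num) 9000 7000 3000 (by norm_num) (by norm_num)
    (by norm_num)
  exact aux_final (10 ^ 9000) (10 ^ 7000) (10 ^ 3000) h1 h2 h3 h4
end
end
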